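/- Let A=(C,m) be a 3-dimensional toric idealistic cluster and Q_i a node of C. Then χ_i < 0 if and only if there exist a label a ∈ {1,2,3} and a child Q_j of Q_i along the edge labelled a with m_j = m_i such that a does not belong to S_i (the set of labels under Q_i), and moreover: m_i ≥ 3 in case S_i = ∅ (i.e. Q_i is the root), m_i ≥ 2 in case #S_i = 1, and no further condition in case #S_i = 2. -/

import Mathlib

open Finset

/-!
Common framework: 3-dimensional toric constellations and toric idealistic clusters.
The edge labels `1, 2, 3` of the paper are encoded as `0, 1, 2 : Fin 3`.
-/

/-- A 3-dimensional toric constellation: a finite rooted tree on nodes `0, …, r−1`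
(node `0` the root, every child having larger index than its parent), each node having
at most three children, the edges from a node to its children carrying pairwise
distinct labels in `Fin 3`.  `label j` is the label of the edge from `parent j` to `j`
(irrelevant for the root). -/
structure ToricConstellation (r : ℕ) where
  parent : Fin r → Fin r
  label : Fin r → Fin 3
  parent_lt : ∀ i : Fin r, 0 < (i : ℕ) → (parent i : ℕ) < (i : ℕ)
  parent_root : ∀ i : Fin r, (i : ℕ) = 0 → parent i = i
  label_distinct : ∀ i j : Fin r, 0 < (i : ℕ) → 0 < (j : ℕ) → i ≠ j →
    parent i = parent j → label i ≠ label j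

namespace ToricConstellation

variable {r : ℕ}

/-- The ordered triple of vectors of `ℤ³` attached to a node: the root carries the
standard basis, and the child along the edge labelled `a` of a node with cone
`(u₁,u₂,u₃)` carries the triple obtained by replacing `u_a` with `u₁+u₂+u₃`. -/
def cone (C : ToricConstellation r) (i : Fin r) : Fin 3 → (Fin 3 → ℤ) :=
  if h : 0 < (i : ℕ) then
    Function.update (cone C (C.parent i)) (C.label i) (∑ a, cone C (C.parent i) a)
  else fun a => Pi.single a 1
termination_by (i : ℕ)
decreasing_by all_goals exact C.parent_lt i h

/-- `v(Q) = u₁ + u₂ + u₃`, the sum of the cone vectors of a node. -/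
def v (C : ToricConstellation r) (i : Fin r) : Fin 3 → ℤ := ∑ a, cone C i a

/-- `Prox C j i` means `j → i`, i.e. `Q_j` is proximate to `Q_i`:
`j ≠ i` and `v(Q_i)` is an entry of `cone(Q_j)`. -/
def Prox (C : ToricConstellation r) (j i : Fin r) : Prop :=
  j ≠ i ∧ ∃ a : Fin 3, cone C j a = v C i

instance (C : ToricConstellation r) (j i : Fin r) : Decidable (C.Prox j i) := by
  unfold Prox; infer_instance

/-- `inChain C i a b j = true` iff `j = Q_i(a, b^t)` for some `t ≥ 0`, i.e. `j` is
reached from `i` by one edge labelled `a` followed by `t` edges labelled `b`. -/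
def inChain (C : ToricConstellation r) (i : Fin r) (a b : Fin 3) (j : Fin r) : Bool :=
  if h : 0 < (j : ℕ) then
    (decide (C.parent j = i) && decide (C.label j = a)) ||
      (decide (C.label j = b) && inChain C i a b (C.parent j))
  else false
termination_by (j : ℕ)
decreasing_by exact C.parent_lt j h

/-- `LinProx C j i` means `j ↠ i`, i.e. `Q_j` is linearly proximate to `Q_i`. -/
def LinProx (C : ToricConstellation r) (j i : Fin r) : Prop :=
  ∃ a b : Fin 3, a ≠ b ∧ inChain C i a b j = true

instance (C : ToricConstellation r) (j i : Fin r) : Decidable (C.LinProx j i) := by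
  unfold LinProx; infer_instance

/-- `j` is a child of `i`. -/
def IsChild (C : ToricConstellation r) (j i : Fin r) : Prop :=
  0 < (j : ℕ) ∧ C.parent j = i

instance (C : ToricConstellation r) (j i : Fin r) : Decidable (C.IsChild j i) := by
  unfold IsChild; infer_instance

/-- The set `S_i` of labels of the edges on the path from the root to `Q_i`. -/
def labelsUnder (C : ToricConstellation r) (i : Fin r) : Finset (Fin 3) :=
  if h : 0 < (i : ℕ) then insert (C.label i) (labelsUnder C (C.parent i)) else ∅
termination_by (i : ℕ)
decreasing_by exact C.parent_lt i h

/-- `i` is a weak ancestor of `j` (`i = j` or `i` a strict ancestor of `j`). -/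
def anc (C : ToricConstellation r) (i j : Fin r) : Bool :=
  decide (i = j) || (if h : 0 < (j : ℕ) then anc C i (C.parent j) else false)
termination_by (j : ℕ)
decreasing_by exact C.parent_lt j h

/-- The set of nodes weakly above `i` (`i` together with its descendants). -/
def weakAbove (C : ToricConstellation r) (i : Fin r) : Finset (Fin r) :=
  univ.filter (fun j => anc C i j = true)

end ToricConstellation

/-- A 3-dimensional toric cluster: a toric constellation together with a positive
integer weight for each node. -/
structure ToricCluster (r : ℕ) extends ToricConstellation r where
  m : Fin r → ℤ
  m_pos : ∀ j, 0 < m j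

namespace ToricCluster

open ToricConstellation

variable {r : ℕ}

/-- `M_{Q_i}(a,b) := Σ_{t ≥ 0, Q_i(a,b^t) ∈ C} m_{Q_i(a,b^t)}`. -/
def M (A : ToricCluster r) (i : Fin r) (a b : Fin 3) : ℤ :=
  ∑ j ∈ univ.filter (fun j => inChain A.toToricConstellation i a b j = true), A.m j

/-- The cluster is idealistic: the linear proximity inequalities
`M_{Q_i}(a,b) + M_{Q_i}(b,a) ≤ m_{Q_i}` hold. -/
def Idealistic (A : ToricCluster r) : Prop :=
  ∀ i : Fin r, ∀ a b : Fin 3, a ≠ b → A.M i a b + A.M i b a ≤ A.m i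

/-- The set of nodes `j` proximate to `i` (`j → i`). -/
def proxSet (A : ToricCluster r) (i : Fin r) : Finset (Fin r) :=
  univ.filter (fun j => Prox A.toToricConstellation j i)

/-- `B_i`: the set of nodes to which `i` is proximate. -/
def Bset (A : ToricCluster r) (i : Fin r) : Finset (Fin r) :=
  univ.filter (fun j => Prox A.toToricConstellation i j)

/-- `A_i`: the children `k` of `i` for which there is no `l` with `i → l` and `k → l`. -/
def Aset (A : ToricCluster r) (i : Fin r) : Finset (Fin r) :=
  univ.filter (fun k => IsChild A.toToricConstellation k i ∧
    ¬ ∃ l, Prox A.toToricConstellation i l ∧ Prox A.toToricConstellation k l)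

/-- The Euler characteristic `χ_i = χ(E_i°)`. -/
def chi (A : ToricCluster r) (i : Fin r) : ℤ :=
  3 + A.m i * (A.m i - 3)
    - ∑ j ∈ A.proxSet i, A.m j * (A.m j - 1)
    + ∑ j ∈ A.proxSet i,
        (A.m j - ∑ k ∈ (A.proxSet i).filter
          (fun k => LinProx A.toToricConstellation k j), A.m k)
    + ∑ j ∈ A.Bset i,
        (A.m i - ∑ k ∈ (A.proxSet j).filter
          (fun k => LinProx A.toToricConstellation k i), A.m k)
    - ((A.Aset i).card : ℤ) - 2 * ((A.Bset i).card : ℤ)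
    + (((A.Bset i).card.choose 2 : ℕ) : ℤ)

/-- `D_i = m_i² − Σ_{j→i} m_j²`. -/
def D (A : ToricCluster r) (i : Fin r) : ℤ :=
  A.m i ^ 2 - ∑ j ∈ A.proxSet i, A.m j ^ 2

/-- `r_{ab} = m_i − M_{Q_i}(a,b) − M_{Q_i}(b,a)`. -/
def rab (A : ToricCluster r) (i : Fin r) (a b : Fin 3) : ℤ :=
  A.m i - A.M i a b - A.M i b a

/-- `R_i = r̂_{12} + r̂_{13} + r̂_{23}`, where `r̂_{ab} = r_{ab}` if the remaining third
label does not appear under `Q_i`, and `r̂_{ab} = 0` otherwise.  (Labels `1,2,3` are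
encoded as `0,1,2 : Fin 3`.) -/
def R (A : ToricCluster r) (i : Fin r) : ℤ :=
  (if (2 : Fin 3) ∉ labelsUnder A.toToricConstellation i then A.rab i 0 1 else 0)
  + (if (1 : Fin 3) ∉ labelsUnder A.toToricConstellation i then A.rab i 0 2 else 0)
  + (if (0 : Fin 3) ∉ labelsUnder A.toToricConstellation i then A.rab i 1 2 else 0)

/-- `T_i = 3 − #A_i − 2·#B_i + (#B_i choose 2)`. -/
def T (A : ToricCluster r) (i : Fin r) : ℤ :=
  3 - ((A.Aset i).card : ℤ) - 2 * ((A.Bset i).card : ℤ)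
    + (((A.Bset i).card.choose 2 : ℕ) : ℤ)

/-- The nodes to which `i` is proximate, of smaller index: the sums in the recursive
definitions of the numerical data range over the nodes to which `i` is proximate,
which are ancestors of `i` and hence have smaller index (making the recursion
well-founded). -/
def anteSet (A : ToricCluster r) (i : Fin r) : Finset (Fin r) :=
  univ.filter (fun j => (j : ℕ) < (i : ℕ) ∧ Prox A.toToricConstellation i j)

/-- The numerical datum `N_i := m_i + Σ_{j : i→j} N_j`. -/
def N (A : ToricCluster r) (i : Fin r) : ℤ :=
  A.m i + ∑ j ∈ (A.anteSet i).attach, N A j.1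
termination_by (i : ℕ)
decreasing_by
  have hj := j.2
  simp only [anteSet, Finset.mem_filter] at hj
  exact hj.2.1

/-- The numerical datum `ν_i := 3 + Σ_{j : i→j} (ν_j − 1)`. -/
def nu (A : ToricCluster r) (i : Fin r) : ℤ :=
  3 + ∑ j ∈ (A.anteSet i).attach, (nu A j.1 - 1)
termination_by (i : ℕ)
decreasing_by
  have hj := j.2
  simp only [anteSet, Finset.mem_filter] at hj
  exact hj.2.1

end ToricCluster


namespace ToricConstellation

variable {r : ℕ}

section Paths

/-- `y` is a child of `x` along an edge whose label lies in `P`. -/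
def Edge (C : ToricConstellation r) (P : Finset (Fin 3)) (x y : Fin r) : Prop :=
  C.IsChild y x ∧ C.label y ∈ P

/-- `y` is reached from `x` by a (possibly empty) path with all labels in `P`. -/
abbrev Reach (C : ToricConstellation r) (P : Finset (Fin 3)) : Fin r → Fin r → Prop :=
  Relation.ReflTransGen (C.Edge P)

variable {C : ToricConstellation r} {P P' : Finset (Fin 3)} {i j k l x y : Fin r} {a b : Fin 3}

lemma IsChild.lt (h : C.IsChild y x) : (x : ℕ) < y := by
  obtain ⟨h0, rfl⟩ := h
  exact C.parent_lt y h0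

lemma IsChild.parent_unique (h : C.IsChild k x) (h' : C.IsChild k y) : x = y :=
  h.2.symm.trans h'.2

lemma IsChild.eq_of_label (h : C.IsChild x j) (h' : C.IsChild y j) (hl : C.label x = C.label y) :
    x = y := by
  by_contra hne
  exact C.label_distinct x y h.1 h'.1 hne (h.2.trans h'.2.symm) hl

lemma Reach.le (h : C.Reach P x y) : (x : ℕ) ≤ y := by
  induction h with
  | refl => exact le_rfl
  | tail _ e ih => exact ih.trans e.1.lt.le

lemma Reach.mono (hP : P ⊆ P') (h : C.Reach P x y) : C.Reach P' x y :=
  Relation.ReflTransGen.mono (p := C.Edge P') (fun _ _ e => ⟨e.1, hP e.2⟩) _ _ h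

lemma Reach.weaken (h : C.Reach P x y) : C.Reach univ x y := h.mono (subset_univ _)

lemma Reach.total (h : C.Reach univ x k) (h' : C.Reach univ y k) :
    C.Reach univ x y ∨ C.Reach univ y x := by
  induction h with
  | refl => exact Or.inr h'
  | @tail b k hb e ih =>
    rcases Relation.ReflTransGen.cases_tail h' with rfl | ⟨c, hc, e'⟩
    · exact Or.inl (hb.tail e)
    · obtain rfl := e.1.parent_unique e'.1
      exact ih hc

lemma Reach.eq_of_siblings (hx : C.IsChild x j) (hy : C.IsChild y j)
    (h : C.Reach univ x y) : x = y := by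
  rcases Relation.ReflTransGen.cases_tail h with rfl | ⟨c, hc, e⟩
  · rfl
  · obtain rfl := e.1.parent_unique hy
    have := Reach.le hc
    have := hx.lt
    omega

lemma branch_unique (hx : C.IsChild x j) (hy : C.IsChild y j)
    (h : C.Reach P x k) (h' : C.Reach P' y k) : x = y := by
  rcases h.weaken.total h'.weaken with H | H
  · exact H.eq_of_siblings hx hy
  · exact (H.eq_of_siblings hy hx).symm

lemma Reach.subpath (h : C.Reach P x k) (hj : C.Reach univ x j) (hk : C.Reach univ j k) :
    C.Reach P j k := by
  induction h with
  | refl =>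
    obtain rfl : j = x := Fin.ext (le_antisymm hk.le hj.le)
    exact .refl
  | @tail b k hb e ih =>
    rcases Relation.ReflTransGen.cases_tail hk with rfl | ⟨c, hc, e'⟩
    · exact .refl
    · obtain rfl := e.1.parent_unique e'.1
      exact (ih hc).tail e

lemma Reach.label_mem (h : C.Reach P j k) (hx : C.IsChild x j) (hk : C.Reach P' x k) :
    C.label x ∈ P := by
  rcases Relation.ReflTransGen.cases_head h with rfl | ⟨y, e, hy⟩
  · have := hx.lt
    have := hk.le
    omega
  · obtain rfl := branch_unique e.1 hx hy hk
    exact e.2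

/-- `j` is the start of the last edge labelled `a` on the path from the root to `i`. -/
def Last (C : ToricConstellation r) (a : Fin 3) (i j : Fin r) : Prop :=
  ∃ x, C.IsChild x j ∧ C.label x = a ∧ C.Reach {a}ᶜ x i

lemma Last.lt (h : C.Last a i j) : (j : ℕ) < i := by
  obtain ⟨x, hx, -, hr⟩ := h
  exact hx.lt.trans_le hr.le

lemma Last.label_unique (h : C.Last a i j) (h' : C.Last b i j) : a = b := by
  obtain ⟨x, hx, rfl, hr⟩ := h
  obtain ⟨y, hy, rfl, hr'⟩ := h'
  rw [branch_unique hx hy hr hr']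

lemma last_child_self (h : C.IsChild k i) : C.Last (C.label k) k l ↔ l = i := by
  constructor
  · rintro ⟨x, hx, hl, hr⟩
    rcases Relation.ReflTransGen.cases_tail hr with rfl | ⟨c, hc, e⟩
    · exact hx.parent_unique h
    · simpa using e.2
  · rintro rfl
    exact ⟨k, h, rfl, .refl⟩

lemma last_child_of_ne (h : C.IsChild k i) (ha : a ≠ C.label k) :
    C.Last a k l ↔ C.Last a i l := by
  constructor
  · rintro ⟨x, hx, hl, hr⟩
    rcases Relation.ReflTransGen.cases_tail hr with rfl | ⟨c, hc, e⟩
    · exact absurd hl.symm ha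
    · obtain rfl := e.1.parent_unique h
      exact ⟨x, hx, hl, hc⟩
  · rintro ⟨x, hx, hl, hr⟩
    exact ⟨x, hx, hl, hr.tail ⟨h, by simpa using ha.symm⟩⟩

lemma not_last_root (h : (i : ℕ) = 0) : ¬ C.Last a i j := fun hl => by
  have := hl.lt
  omega

lemma induction_on {motive : Fin r → Prop} (C : ToricConstellation r)
    (root : ∀ i : Fin r, (i : ℕ) = 0 → motive i)
    (child : ∀ i j, C.IsChild j i → motive i → motive j) (i : Fin r) : motive i := by
  induction i using WellFoundedLT.induction with
  | ind i ih =>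
    rcases Nat.eq_zero_or_pos (i : ℕ) with h | h
    · exact root i h
    · exact child (C.parent i) i ⟨h, rfl⟩ (ih _ (C.parent_lt i h))

lemma Last.unique (h : C.Last a i j) (h' : C.Last a i k) : j = k := by
  induction i using C.induction_on with
  | root i h0 => exact absurd h (not_last_root h0)
  | child i c hc ih =>
    by_cases ha : a = C.label c
    · subst ha
      rw [(last_child_self hc).1 h, (last_child_self hc).1 h']
    · exact ih ((last_child_of_ne hc ha).1 h) ((last_child_of_ne hc ha).1 h')

lemma labelsUnder_root (h : (i : ℕ) = 0) : C.labelsUnder i = ∅ := by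
  rw [labelsUnder, dif_neg (by omega)]

lemma labelsUnder_child (h : C.IsChild k i) :
    C.labelsUnder k = insert (C.label k) (C.labelsUnder i) := by
  rw [labelsUnder, dif_pos h.1, h.2]

lemma mem_labelsUnder : a ∈ C.labelsUnder i ↔ ∃ j, C.Last a i j := by
  induction i using C.induction_on with
  | root i h0 => simp [labelsUnder_root h0, not_last_root h0]
  | child i c hc ih =>
    rw [labelsUnder_child hc, mem_insert]
    by_cases ha : a = C.label c
    · subst ha
      simp [last_child_self hc]
    · simp [last_child_of_ne hc ha, ha, ih]

lemma inChain_iff : C.inChain i a b j = true ↔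
    ∃ x, C.IsChild x i ∧ C.label x = a ∧ C.Reach {b} x j := by
  induction j using C.induction_on with
  | root j h0 =>
    rw [inChain, dif_neg (by omega)]
    simp only [Bool.false_eq_true, false_iff, not_exists, not_and]
    intro x hx _ hr
    have := hx.lt
    have := hr.le
    omega
  | child p j hj ih =>
    rw [inChain, dif_pos hj.1, hj.2]
    simp only [Bool.or_eq_true, Bool.and_eq_true, decide_eq_true_eq, ih]
    constructor
    · rintro (⟨rfl, hl⟩ | ⟨hl, x, hx, hxa, hr⟩)
      · exact ⟨j, hj, hl, .refl⟩
      · exact ⟨x, hx, hxa, hr.tail ⟨hj, by simpa using hl⟩⟩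
    · rintro ⟨x, hx, hxa, hr⟩
      rcases Relation.ReflTransGen.cases_tail hr with rfl | ⟨c, hc, e⟩
      · exact Or.inl ⟨hj.parent_unique hx, hxa⟩
      · obtain rfl := e.1.parent_unique hj
        exact Or.inr ⟨by simpa using e.2, x, hx, hxa, hc⟩

end Paths

section Vectors

/-- The linear map sending `e_a` to `e_1 + e_2 + e_3` and fixing the other basis vectors. -/
def subdivide (a : Fin 3) : (Fin 3 → ℤ) →ₗ[ℤ] (Fin 3 → ℤ) where
  toFun x := fun b => if b = a then x a else x b + x a
  map_add' x y := by
    ext b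
    by_cases h : b = a <;> simp [h]
    ring
  map_smul' c x := by
    ext b
    by_cases h : b = a <;> simp [h]
    ring

/-- The composite of the maps `subdivide a` along a word. -/
def subdivideWord (w : List (Fin 3)) : (Fin 3 → ℤ) →ₗ[ℤ] (Fin 3 → ℤ) :=
  w.foldr (fun a f => (subdivide a).comp f) LinearMap.id

lemma subdivideWord_cons (a : Fin 3) (w : List (Fin 3)) (x : Fin 3 → ℤ) :
    subdivideWord (a :: w) x = subdivide a (subdivideWord w x) := rfl

lemma subdivideWord_concat (w : List (Fin 3)) (a : Fin 3) (x : Fin 3 → ℤ) :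
    subdivideWord (w ++ [a]) x = subdivideWord w (subdivide a x) := by
  induction w with
  | nil => rfl
  | cons b w ih => simp only [List.cons_append, subdivideWord_cons, ih]

lemma subdivide_single_self (a : Fin 3) : subdivide a (Pi.single a 1) = 1 := by
  ext b
  by_cases h : b = a <;> simp [subdivide, h]

lemma subdivide_single_of_ne {a c : Fin 3} (h : c ≠ a) :
    subdivide a (Pi.single c 1) = Pi.single c 1 := by
  ext b
  by_cases hb : b = a <;> simp [subdivide, hb, h.symm]

lemma subdivideWord_one_pos (w : List (Fin 3)) (b : Fin 3) : 0 < subdivideWord w 1 b := by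
  induction w generalizing b with
  | nil => simp [subdivideWord]
  | cons a w ih =>
    rw [subdivideWord_cons]
    have h1 := ih a
    have h2 := ih b
    by_cases hb : b = a <;> simp [subdivide, hb] <;> omega

lemma subdivide_injective (a : Fin 3) : Function.Injective (subdivide a) := by
  intro x y h
  have ha : x a = y a := by simpa [subdivide] using congrFun h a
  ext b
  by_cases hb : b = a
  · rw [hb, ha]
  · simpa [subdivide, hb, ha] using congrFun h b

lemma subdivideWord_one_injective :
    Function.Injective fun w : List (Fin 3) => subdivideWord w 1 := by
  have nil_ne : ∀ a w, subdivideWord [] 1 ≠ subdivideWord (a :: w) 1 := by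
    intro a w h
    have h1 : 1 = subdivideWord w 1 a := by
      simpa [subdivideWord_cons, subdivide, subdivideWord] using congrFun h a
    have h2 : 1 = subdivideWord w 1 (a + 1) + subdivideWord w 1 a := by
      simpa [subdivideWord_cons, subdivide, subdivideWord] using congrFun h (a + 1)
    have := subdivideWord_one_pos w (a + 1)
    omega
  intro w
  induction w with
  | nil =>
    rintro (_ | ⟨a, w⟩) h
    · rfl
    · exact absurd h (nil_ne a w)
  | cons a w ih =>
    rintro (_ | ⟨b, w'⟩) h
    · exact absurd h.symm (nil_ne a w)
    · simp only [subdivideWord_cons] at h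
      by_cases hab : a = b
      · subst hab
        rw [ih (subdivide_injective a h)]
      · have h1 : subdivideWord w 1 a = subdivideWord w' 1 a + subdivideWord w' 1 b := by
          simpa [subdivide, hab] using congrFun h a
        have h2 : subdivideWord w 1 b + subdivideWord w 1 a = subdivideWord w' 1 b := by
          simpa [subdivide, Ne.symm hab] using congrFun h b
        have := subdivideWord_one_pos w b
        have := subdivideWord_one_pos w' a
        omega

/-- The word of labels read along the path from the root to a node. -/
def word (C : ToricConstellation r) (i : Fin r) : List (Fin 3) :=
  if h : 0 < (i : ℕ) then word C (C.parent i) ++ [C.label i] else []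
termination_by (i : ℕ)
decreasing_by exact C.parent_lt i h

variable {C : ToricConstellation r} {i j k : Fin r} {a : Fin 3}

lemma word_root (h : (i : ℕ) = 0) : C.word i = [] := by
  rw [word, dif_neg (by omega)]

lemma word_child (h : C.IsChild k i) : C.word k = C.word i ++ [C.label k] := by
  rw [word, dif_pos h.1, h.2]

lemma word_injective (C : ToricConstellation r) : Function.Injective C.word := by
  intro i
  induction i using C.induction_on with
  | root i h0 =>
    intro j h
    rcases Nat.eq_zero_or_pos (j : ℕ) with hj | hj
    · exact Fin.ext (h0.trans hj.symm)
    · simp [word_root h0, word_child (C := C) ⟨hj, rfl⟩] at h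
  | child p i hi ih =>
    intro j h
    rcases Nat.eq_zero_or_pos (j : ℕ) with hj | hj
    · simp [word_root hj, word_child hi] at h
    · have hc : C.IsChild j (C.parent j) := ⟨hj, rfl⟩
      rw [word_child hi, word_child hc] at h
      obtain ⟨h1, h2⟩ := List.append_inj' h rfl
      exact hi.eq_of_label ((ih h1).symm ▸ hc) (by simpa using h2)

lemma sum_single_one : ∑ a : Fin 3, (Pi.single a 1 : Fin 3 → ℤ) = 1 := by
  ext b
  fin_cases b <;> simp

lemma cone_root (h : (i : ℕ) = 0) : C.cone i a = Pi.single a 1 := by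
  rw [cone, dif_neg (by omega)]

lemma cone_child (h : C.IsChild k i) :
    C.cone k = Function.update (C.cone i) (C.label k) (C.v i) := by
  rw [cone, dif_pos h.1, h.2, v]

lemma cone_eq_subdivideWord (i : Fin r) (a : Fin 3) :
    C.cone i a = subdivideWord (C.word i) (Pi.single a 1) := by
  induction i using C.induction_on generalizing a with
  | root i h0 => rw [cone_root h0, word_root h0]; rfl
  | child p i hi ih =>
    rw [cone_child hi, word_child hi, subdivideWord_concat]
    by_cases ha : a = C.label i
    · subst ha
      rw [Function.update_self, subdivide_single_self, ← sum_single_one, map_sum, v]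
      exact sum_congr rfl fun a _ => ih a
    · rw [Function.update_of_ne ha, subdivide_single_of_ne ha, ih]

lemma v_eq_subdivideWord (i : Fin r) : C.v i = subdivideWord (C.word i) 1 := by
  rw [← sum_single_one, map_sum, v]
  exact sum_congr rfl fun a _ => cone_eq_subdivideWord i a

lemma v_injective (C : ToricConstellation r) : Function.Injective C.v := by
  intro i j h
  rw [v_eq_subdivideWord, v_eq_subdivideWord] at h
  exact C.word_injective (subdivideWord_one_injective h)

lemma v_ne_single (i : Fin r) (a : Fin 3) : C.v i ≠ Pi.single a 1 := by
  intro h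
  have h1 := subdivideWord_one_pos (C.word i) (a + 1)
  rw [← v_eq_subdivideWord, h] at h1
  simp at h1

lemma cone_eq_v_iff : C.cone j a = C.v i ↔ C.Last a j i := by
  induction j using C.induction_on with
  | root j h0 =>
    rw [cone_root h0]
    exact iff_of_false (v_ne_single i a).symm (not_last_root h0)
  | child p j hj ih =>
    rw [cone_child hj]
    by_cases ha : a = C.label j
    · subst ha
      rw [Function.update_self, last_child_self hj, C.v_injective.eq_iff, eq_comm]
    · rw [Function.update_of_ne ha, ih, last_child_of_ne hj ha]

lemma prox_iff : C.Prox j i ↔ ∃ a, C.Last a j i := by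
  simp only [Prox, cone_eq_v_iff, and_iff_right_iff_imp]
  rintro ⟨a, h⟩ rfl
  exact h.lt.false

end Vectors

end ToricConstellation

namespace ToricConstellation

variable {r : ℕ}

/-- The value of `g` at the child of `j` along the edge labelled `a`, or `0` if there is none. -/
def branchSum (C : ToricConstellation r) (a : Fin 3) (g : Fin r → ℤ) (j : Fin r) : ℤ :=
  ∑ x with C.IsChild x j ∧ C.label x = a, g x

open Classical in
/-- The sum of `g` over all nodes reached from `j` by paths with labels in `P`. -/
noncomputable def reachSum (C : ToricConstellation r) (P : Finset (Fin 3)) (g : Fin r → ℤ)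
    (j : Fin r) : ℤ :=
  ∑ k with C.Reach P j k, g k

variable {C : ToricConstellation r} {P : Finset (Fin 3)} {i j k x : Fin r} {a b : Fin 3}
  {g g' : Fin r → ℤ}

lemma branchSum_of_child (hx : C.IsChild x j) (hl : C.label x = a) (g : Fin r → ℤ) :
    C.branchSum a g j = g x := by
  have : ({y | C.IsChild y j ∧ C.label y = a} : Finset (Fin r)) = {x} := by
    ext y
    simp only [mem_filter, mem_univ, true_and, mem_singleton]
    constructor
    · rintro ⟨hy, hl'⟩
      exact hy.eq_of_label hx (hl'.trans hl.symm)
    · rintro rfl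
      exact ⟨hx, hl⟩
  rw [branchSum, this, sum_singleton]

lemma branchSum_of_forall_ne (h : ∀ x, C.IsChild x j → C.label x ≠ a) (g : Fin r → ℤ) :
    C.branchSum a g j = 0 := by
  rw [branchSum, filter_eq_empty_iff.2, sum_empty]
  rintro x - ⟨hx, hl⟩
  exact h x hx hl

lemma branchSum_cases (C : ToricConstellation r) (a : Fin 3) (j : Fin r) :
    (∃ x, C.IsChild x j ∧ C.label x = a ∧ ∀ g, C.branchSum a g j = g x) ∨
      (∀ x, C.IsChild x j → C.label x ≠ a) ∧ ∀ g, C.branchSum a g j = 0 := by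
  by_cases h : ∃ x, C.IsChild x j ∧ C.label x = a
  · obtain ⟨x, hx, hl⟩ := h
    exact Or.inl ⟨x, hx, hl, branchSum_of_child hx hl⟩
  · push Not at h
    exact Or.inr ⟨h, branchSum_of_forall_ne h⟩

lemma branchSum_add (g g' : Fin r → ℤ) :
    C.branchSum a (fun x => g x + g' x) j = C.branchSum a g j + C.branchSum a g' j :=
  sum_add_distrib

lemma branchSum_congr (h : ∀ x, C.IsChild x j → C.label x = a → g x = g' x) :
    C.branchSum a g j = C.branchSum a g' j :=
  sum_congr rfl fun x hx => h x (by simp_all) (by simp_all)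

lemma reachSum_congr (h : ∀ k, C.Reach P j k → g k = g' k) :
    C.reachSum P g j = C.reachSum P g' j :=
  sum_congr rfl fun k hk => h k (by simpa using hk)

lemma reachSum_add (g g' : Fin r → ℤ) :
    C.reachSum P (fun x => g x + g' x) j = C.reachSum P g j + C.reachSum P g' j :=
  sum_add_distrib

open Classical in
lemma branchSum_reachSum (g : Fin r → ℤ) :
    C.branchSum a (C.reachSum P g) i =
      ∑ k with ∃ x, C.IsChild x i ∧ C.label x = a ∧ C.Reach P x k, g k := by
  rcases C.branchSum_cases a i with ⟨x, hx, hl, h⟩ | ⟨hne, h⟩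
  · rw [h, reachSum]
    congr 1
    ext k
    simp only [mem_filter, mem_univ, true_and]
    constructor
    · exact fun hk => ⟨x, hx, hl, hk⟩
    · rintro ⟨y, hy, hl', hk⟩
      rwa [hx.eq_of_label hy (hl.trans hl'.symm)]
  · rw [h, filter_eq_empty_iff.2, sum_empty]
    rintro k - ⟨x, hx, hl, -⟩
    exact hne x hx hl

lemma reachSum_eq (P : Finset (Fin 3)) (g : Fin r → ℤ) (j : Fin r) :
    C.reachSum P g j = g j + ∑ a ∈ P, C.branchSum a (C.reachSum P g) j := by
  classical
  have hset : ({k | C.Reach P j k} : Finset (Fin r)) =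
      insert j (P.biUnion fun a =>
        ({k | ∃ x, C.IsChild x j ∧ C.label x = a ∧ C.Reach P x k} : Finset (Fin r))) := by
    ext k
    simp only [mem_filter, mem_univ, true_and, mem_insert, mem_biUnion]
    constructor
    · intro h
      rcases Relation.ReflTransGen.cases_head h with rfl | ⟨y, e, hy⟩
      · exact Or.inl rfl
      · exact Or.inr ⟨_, e.2, y, e.1, rfl, hy⟩
    · rintro (rfl | ⟨a, ha, x, hx, rfl, hk⟩)
      · exact .refl
      · exact .head ⟨hx, ha⟩ hk
  simp only [branchSum_reachSum]
  rw [reachSum, hset, sum_insert, sum_biUnion]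
  · intro a _ b _ hab
    rw [Function.onFun, disjoint_left]
    intro k h1 h2
    obtain ⟨x, hx, rfl, hk⟩ := (mem_filter.1 h1).2
    obtain ⟨y, hy, rfl, hk'⟩ := (mem_filter.1 h2).2
    exact hab (by rw [branch_unique hx hy hk hk'])
  · simp only [mem_biUnion, mem_filter, mem_univ, true_and]
    rintro ⟨a, ha, x, hx, -, hk⟩
    have := hx.lt
    have := hk.le
    omega

lemma reachSum_singleton_eq (b : Fin 3) (g : Fin r → ℤ) (j : Fin r) :
    C.reachSum {b} g j = g j + C.branchSum b (C.reachSum {b} g) j := by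
  rw [reachSum_eq, sum_singleton]

lemma reachSum_compl_eq (a : Fin 3) (g : Fin r → ℤ) (j : Fin r) :
    C.reachSum {a}ᶜ g j = g j + C.branchSum (a + 1) (C.reachSum {a}ᶜ g) j +
      C.branchSum (a + 2) (C.reachSum {a}ᶜ g) j := by
  have h : ({a}ᶜ : Finset (Fin 3)) = {a + 1, a + 2} := by decide +revert
  have hne : a + 1 ≠ a + 2 := by decide +revert
  rw [reachSum_eq, h, sum_pair hne, add_assoc]

lemma sum_prox (g : Fin r → ℤ) (i : Fin r) :
    ∑ k with C.Prox k i, g k = ∑ a, C.branchSum a (C.reachSum {a}ᶜ g) i := by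
  classical
  simp only [branchSum_reachSum]
  rw [← sum_biUnion]
  · congr 1
    ext k
    simp [prox_iff, Last]
  · intro a _ b _ hab
    rw [Function.onFun, disjoint_left]
    intro k h1 h2
    exact hab (Last.label_unique (mem_filter.1 h1).2 (mem_filter.1 h2).2)

lemma induction_on_children {motive : Fin r → Prop} (C : ToricConstellation r)
    (step : ∀ i, (∀ k, C.IsChild k i → motive k) → motive i) (i : Fin r) : motive i := by
  induction i using WellFoundedGT.induction with
  | ind i ih => exact step i fun k hk => ih k hk.lt

end ToricConstellation

namespace ToricCluster

open ToricConstellation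

variable {r : ℕ} {A : ToricCluster r} {i j k x : Fin r} {a b : Fin 3}

lemma M_eq_branchSum (A : ToricCluster r) (i : Fin r) (a b : Fin 3) :
    A.M i a b = A.branchSum a (A.reachSum {b} A.m) i := by
  classical
  simp only [M, inChain_iff, branchSum_reachSum]

/-- The linear proximity excess `m_j - M_j(b,c) - M_j(c,b)`, where `{a, b, c}` is the set of
all labels. -/
def excess (A : ToricCluster r) (a : Fin 3) (j : Fin r) : ℤ :=
  A.m j - (A.M j (a + 1) (a + 2) + A.M j (a + 2) (a + 1))

lemma Idealistic.excess_nonneg (hA : A.Idealistic) (a : Fin 3) (j : Fin r) :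
    0 ≤ A.excess a j :=
  sub_nonneg.2 (hA j _ _ (by decide +revert))

lemma other_labels (a : Fin 3) : a + 1 ≠ a ∧ a + 2 ≠ a ∧ a + 1 ≠ a + 2 ∧
    ∀ b, b ≠ a → b = a + 1 ∨ b = a + 2 := by
  decide +revert

lemma prox_linProx_iff (h : A.Last a j i) :
    A.Prox k i ∧ A.LinProx k j ↔
      A.inChain j (a + 1) (a + 2) k = true ∨ A.inChain j (a + 2) (a + 1) k = true := by
  obtain ⟨h1, h2, h12, hlab⟩ := other_labels a
  obtain ⟨x, hx, hxa, hr⟩ := h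
  constructor
  · rintro ⟨hp, p, q, hpq, hk⟩
    obtain ⟨a', x', hx', hxa', hr'⟩ := prox_iff.1 hp
    obtain ⟨z, hz, rfl, hzk⟩ := inChain_iff.1 hk
    have hjz : A.Reach univ j z := .single ⟨hz, mem_univ _⟩
    obtain rfl := branch_unique hx hx' (hr.weaken.trans (hjz.trans hzk.weaken)) hr'
    obtain rfl := hxa.symm.trans hxa'
    have hjk := hr'.subpath hr.weaken (hjz.trans hzk.weaken)
    have hza := hjk.label_mem hz hzk
    have hzk' := hjk.subpath hjz hzk.weaken
    have hza : A.label z ≠ a := by simpa using hza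
    simp only [inChain_iff]
    rcases Relation.ReflTransGen.cases_head hzk with rfl | ⟨w, e, hw⟩
    · rcases hlab _ hza with hl | hl
      · exact Or.inl ⟨z, hz, hl, .refl⟩
      · exact Or.inr ⟨z, hz, hl, .refl⟩
    · have hq : q ≠ a := by
        have h1 := hzk'.label_mem e.1 hw
        have h2 := e.2
        simp only [mem_compl, mem_singleton] at h1 h2
        rwa [h2] at h1
      rcases hlab _ hza with hl | hl <;> rcases hlab _ hq with hl' | hl' <;> rw [hl'] at hzk hpq
      · exact absurd hl hpq
      · exact Or.inl ⟨z, hz, hl, hzk⟩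
      · exact Or.inr ⟨z, hz, hl, hzk⟩
      · exact absurd hl hpq
  · have key : ∀ {p q}, p ≠ a → q ≠ a → p ≠ q → A.inChain j p q k = true →
        A.Prox k i ∧ A.LinProx k j := by
      intro p q hp hq hpq hk
      refine ⟨prox_iff.2 ⟨a, x, hx, hxa, hr.trans ?_⟩, p, q, hpq, hk⟩
      obtain ⟨z, hz, hl, hzk⟩ := inChain_iff.1 hk
      exact .head ⟨hz, by simpa [hl] using hp⟩ (hzk.mono (by simpa using hq.symm))
    rintro (hk | hk)
    · exact key h1 h2 h12 hk
    · exact key h2 h1 h12.symm hk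

lemma sum_prox_linProx (h : A.Last a j i) :
    ∑ k ∈ (A.proxSet i).filter (fun k => LinProx A.toToricConstellation k j), A.m k =
      A.M j (a + 1) (a + 2) + A.M j (a + 2) (a + 1) := by
  rw [M, M, ← sum_union]
  · congr 1
    ext k
    simpa [proxSet] using prox_linProx_iff h
  · rw [disjoint_left]
    simp only [mem_filter, mem_univ, true_and, inChain_iff]
    rintro k ⟨x, hx, hl, hk⟩ ⟨y, hy, hl', hk'⟩
    obtain rfl := branch_unique hx hy hk hk'
    exact (other_labels a).2.2.1 (hl.symm.trans hl')

lemma reachSum_weight_add_excess (A : ToricCluster r) (a : Fin 3) (j : Fin r) :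
    A.reachSum {a}ᶜ (fun k => A.m k + A.excess a k) j =
      A.reachSum {a + 1} A.m j + A.reachSum {a + 2} A.m j := by
  induction j using A.induction_on_children with
  | step j ih =>
    rw [reachSum_compl_eq, branchSum_congr fun x hx _ => ih x hx,
      branchSum_congr fun x hx _ => ih x hx, branchSum_add, branchSum_add,
      reachSum_singleton_eq (a + 1), reachSum_singleton_eq (a + 2), excess,
      M_eq_branchSum, M_eq_branchSum]
    ring

lemma weight_le_reachSum (A : ToricCluster r) (P : Finset (Fin 3)) (j : Fin r) :
    A.m j ≤ A.reachSum P A.m j := by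
  classical
  exact single_le_sum (fun k _ => (A.m_pos k).le) (by simp [Relation.ReflTransGen.refl])

lemma mul_max_le_of_le {n p q : ℤ} (hp : 0 ≤ p) (hq : 0 ≤ q) (hnp : n ≤ p) (hnq : n ≤ q) :
    n * max p q ≤ p * q := by
  rcases max_cases p q with ⟨h, _⟩ | ⟨h, _⟩ <;> rw [h] <;> nlinarith

lemma Idealistic.reachSum_sq_le (hA : A.Idealistic) (a : Fin 3) (j : Fin r) :
    A.reachSum {a}ᶜ (fun k => A.m k ^ 2) j ≤
      A.m j * max (A.reachSum {a + 1} A.m j) (A.reachSum {a + 2} A.m j) := by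
  induction j using A.induction_on_children with
  | step j ih =>
    have sub : ∀ b, A.branchSum b (A.reachSum {a}ᶜ fun k => A.m k ^ 2) j ≤
        A.branchSum b (A.reachSum {a + 1} A.m) j * A.branchSum b (A.reachSum {a + 2} A.m) j ∧
        0 ≤ A.branchSum b (A.reachSum {a + 1} A.m) j ∧
        0 ≤ A.branchSum b (A.reachSum {a + 2} A.m) j := by
      intro b
      rcases A.branchSum_cases b j with ⟨x, hx, -, h⟩ | ⟨-, h⟩
      · simp only [h]
        have h0 := A.m_pos x
        have h1 := A.weight_le_reachSum {a + 1} x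
        have h2 := A.weight_le_reachSum {a + 2} x
        exact ⟨(ih x hx).trans (mul_max_le_of_le (by omega) (by omega) h1 h2),
          by omega, by omega⟩
      · simp [h]
    obtain ⟨h1, h2, h3⟩ := sub (a + 1)
    obtain ⟨h4, h5, h6⟩ := sub (a + 2)
    have h7 := hA.excess_nonneg a j
    rw [excess, M_eq_branchSum, M_eq_branchSum] at h7
    have h8 := A.m_pos j
    rw [reachSum_compl_eq, reachSum_singleton_eq (a + 1), reachSum_singleton_eq (a + 2)]
    generalize A.branchSum (a + 1) (A.reachSum {a + 1} A.m) j = u at *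
    generalize A.branchSum (a + 2) (A.reachSum {a + 2} A.m) j = w at *
    generalize A.branchSum (a + 1) (A.reachSum {a + 2} A.m) j = s at *
    generalize A.branchSum (a + 2) (A.reachSum {a + 1} A.m) j = t at *
    generalize A.m j = n at *
    rcases le_total u w with h | h
    · rw [max_eq_right (by omega)]
      nlinarith
    · rw [max_eq_left (by omega)]
      nlinarith

lemma sum_Bset {f : Fin r → ℤ} {g : Fin 3 → ℤ} (h : ∀ a j, A.Last a i j → f j = g a) :
    ∑ j ∈ A.Bset i, f j = ∑ a ∈ A.labelsUnder i, g a := by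
  symm
  refine sum_bij (fun a ha => (mem_labelsUnder.1 ha).choose) ?_ ?_ ?_ ?_
  · intro a ha
    simp only [Bset, mem_filter, mem_univ, true_and]
    exact prox_iff.2 ⟨a, (mem_labelsUnder.1 ha).choose_spec⟩
  · intro a ha b hb hab
    have h1 := (mem_labelsUnder.1 ha).choose_spec
    rw [hab] at h1
    exact h1.label_unique (mem_labelsUnder.1 hb).choose_spec
  · intro j hj
    simp only [Bset, mem_filter, mem_univ, true_and] at hj
    obtain ⟨a, ha⟩ := prox_iff.1 hj
    have hm := mem_labelsUnder.2 ⟨j, ha⟩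
    exact ⟨a, hm, (mem_labelsUnder.1 hm).choose_spec.unique ha⟩
  · intro a ha
    exact (h a _ (mem_labelsUnder.1 ha).choose_spec).symm

lemma card_Bset (A : ToricCluster r) (i : Fin r) :
    (A.Bset i).card = (A.labelsUnder i).card := by
  have := sum_Bset (A := A) (i := i) (f := fun _ => 1) (g := fun _ => 1) fun _ _ _ => rfl
  simpa using this

lemma exists_common_prox_iff (h : A.IsChild k i) :
    (∃ l, A.Prox i l ∧ A.Prox k l) ↔ ¬ A.labelsUnder i ⊆ {A.label k} := by
  simp only [subset_iff, mem_singleton, not_forall, prox_iff, exists_prop, mem_labelsUnder]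
  constructor
  · rintro ⟨l, ⟨b, hb⟩, c, hc⟩
    refine ⟨c, ?_⟩
    by_cases hck : c = A.label k
    · subst hck
      obtain rfl := (last_child_self h).1 hc
      exact absurd hb.lt (lt_irrefl _)
    · exact ⟨⟨l, (last_child_of_ne h hck).1 hc⟩, hck⟩
  · rintro ⟨c, ⟨l, hl⟩, hc⟩
    exact ⟨l, ⟨c, hl⟩, c, (last_child_of_ne h hc).2 hl⟩

lemma card_Aset (A : ToricCluster r) (i : Fin r) :
    ((A.Aset i).card : ℤ) =
      ∑ a, if A.labelsUnder i ⊆ {a} then A.branchSum a (fun _ => 1) i else 0 := by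
  have : A.Aset i = univ.filter (fun k => A.IsChild k i ∧ A.labelsUnder i ⊆ {A.label k}) := by
    ext k
    simp only [Aset, mem_filter, mem_univ, true_and]
    exact and_congr_right fun h => by rw [exists_common_prox_iff h, not_not]
  rw [this, card_eq_sum_card_fiberwise (f := A.label) (t := univ) (by simp)]
  push_cast
  refine sum_congr rfl fun a _ => ?_
  rw [filter_filter, branchSum, sum_const, nsmul_one]
  split_ifs with h
  · congr 2
    ext k
    simp only [mem_filter, mem_univ, true_and]
    constructor
    · rintro ⟨⟨h1, -⟩, h2⟩
      exact ⟨h1, h2⟩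
    · rintro ⟨h1, rfl⟩
      exact ⟨⟨h1, h⟩, rfl⟩
  · rw [Nat.cast_eq_zero, card_eq_zero, filter_eq_empty_iff]
    rintro k - ⟨⟨-, h2⟩, rfl⟩
    exact h h2

/-- `χ_i` in terms of the areas cut off by the branches, the excesses for the labels not under
`i`, and the number of labels under `i`. -/
lemma chi_eq (A : ToricCluster r) (i : Fin r) :
    A.chi i = A.m i ^ 2 - ∑ a, A.branchSum a (A.reachSum {a}ᶜ fun k => A.m k ^ 2) i
      - ∑ a, (if a ∈ A.labelsUnder i then 0 else A.excess a i) + 3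
      - ∑ a, (if A.labelsUnder i ⊆ {a} then A.branchSum a (fun _ => 1) i else 0)
      - 2 * (A.labelsUnder i).card + ((A.labelsUnder i).card.choose 2 : ℕ) := by
  have hB : ∑ j ∈ A.Bset i, (A.m i - ∑ k ∈ (A.proxSet j).filter
      (fun k => LinProx A.toToricConstellation k i), A.m k) =
      ∑ a, A.excess a i - ∑ a, (if a ∈ A.labelsUnder i then 0 else A.excess a i) := by
    rw [sum_Bset (g := fun a => A.excess a i), ← sum_sub_distrib, ← sum_filter_add_sum_filter_not
      univ (· ∈ A.labelsUnder i)]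
    · rw [sum_eq_zero (s := univ.filter (· ∉ A.labelsUnder i))]
      · rw [add_zero, filter_univ_mem]
        exact sum_congr rfl fun a ha => by simp [ha]
      · intro a ha
        simp_all
    · intro a j h
      rw [sum_prox_linProx h, excess]
  have hP : ∑ j ∈ A.proxSet i, (A.m j - ∑ k ∈ (A.proxSet i).filter
      (fun k => LinProx A.toToricConstellation k j), A.m k) =
      ∑ a, A.branchSum a (A.reachSum {a}ᶜ (A.excess a)) i := by
    rw [proxSet, sum_prox]
    refine sum_congr rfl fun a _ => branchSum_congr fun x hx hl => reachSum_congr fun k hk => ?_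
    have := sum_prox_linProx (A := A) ⟨x, hx, hl, hk⟩
    rw [proxSet] at this
    rw [this, excess]
  have hW : ∑ j ∈ A.proxSet i, A.m j * (A.m j - 1) =
      ∑ a, A.branchSum a (A.reachSum {a}ᶜ fun k => A.m k ^ 2) i -
      ∑ a, A.branchSum a (A.reachSum {a}ᶜ A.m) i := by
    rw [proxSet, ← sum_prox, ← sum_prox, ← sum_sub_distrib]
    exact sum_congr rfl fun k _ => by ring
  have hE : ∀ a, A.branchSum a (A.reachSum {a}ᶜ A.m) i +
      A.branchSum a (A.reachSum {a}ᶜ (A.excess a)) i = A.M i a (a + 1) + A.M i a (a + 2) := by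
    intro a
    rw [M_eq_branchSum, M_eq_branchSum, ← branchSum_add, ← branchSum_add]
    refine branchSum_congr fun x _ _ => ?_
    rw [← reachSum_add, reachSum_weight_add_excess]
  have hE' : ∑ a, A.branchSum a (A.reachSum {a}ᶜ A.m) i +
      ∑ a, A.branchSum a (A.reachSum {a}ᶜ (A.excess a)) i =
      3 * A.m i - ∑ a, A.excess a i := by
    rw [← sum_add_distrib, sum_congr rfl fun a _ => hE a]
    simp only [excess, Fin.sum_univ_three]
    simp only [Fin.reduceAdd]
    ring
  rw [chi, hB, hP, hW, card_Aset, card_Bset]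
  linear_combination hE'

end ToricCluster

/-- The numerical constraints on one branch at a node: `c` is the number of children along the
branch, `n` the weight of the child, `p` and `q` the two linear sums, `E` the sum of the squares
of the weights of the proximate nodes in the branch. -/
def BranchBounds (c n p q E : ℤ) : Prop :=
  (c = 0 ∧ n = 0 ∧ p = 0 ∧ q = 0 ∧ E = 0) ∨
    (c = 1 ∧ 1 ≤ n ∧ n ≤ p ∧ n ≤ q ∧ n ^ 2 ≤ E ∧ E ≤ n * max p q)

namespace BranchBounds

variable {c n p q E m c₀ n₀ p₀ q₀ E₀ c₁ n₁ p₁ q₁ E₁ c₂ n₂ p₂ q₂ E₂ : ℤ}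

lemma swap (h : BranchBounds c n p q E) : BranchBounds c n q p E := by
  rcases h with ⟨h1, h2, h3, h4, h5⟩ | ⟨h1, h2, h3, h4, h5, h6⟩
  · exact Or.inl ⟨h1, h2, h4, h3, h5⟩
  · exact Or.inr ⟨h1, h2, h4, h3, h5, max_comm p q ▸ h6⟩

lemma nonneg (h : BranchBounds c n p q E) : 0 ≤ p ∧ 0 ≤ q ∧ 0 ≤ c ∧ 0 ≤ E := by
  rcases h with ⟨h1, h2, h3, h4, h5⟩ | ⟨h1, h2, h3, h4, h5, h6⟩
  · omega
  · have := sq_nonneg n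
    omega

lemma le_mul (h : BranchBounds c n p q E) : E ≤ p * q := by
  rcases h with ⟨h1, h2, h3, h4, h5⟩ | ⟨h1, h2, h3, h4, h5, h6⟩
  · simp [h3, h5]
  · exact h6.trans (ToricCluster.mul_max_le_of_le (by omega) (by omega) h3 h4)

lemma le_sub_one_mul (h : BranchBounds c n p q E) (hn : n < m) (hp : p ≤ m) (hq : q ≤ m) :
    E ≤ (m - 1) * m := by
  rcases h with ⟨h1, h2, h3, h4, h5⟩ | ⟨h1, h2, h3, h4, h5, h6⟩
  · nlinarith
  · have h7 : max p q ≤ m := max_le hp hq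
    have h8 := le_max_left p q
    nlinarith

lemma sum_le_sq (h₀ : BranchBounds c₀ n₀ p₀ q₀ E₀) (h₁ : BranchBounds c₁ n₁ p₁ q₁ E₁)
    (h₂ : BranchBounds c₂ n₂ p₂ q₂ E₂) (e₀ : p₁ + q₂ ≤ m) (e₁ : p₂ + q₀ ≤ m)
    (e₂ : p₀ + q₁ ≤ m) :
    E₀ + E₁ + E₂ ≤ m ^ 2 - (p₀ * (m - p₂ - q₀) + p₁ * (m - p₀ - q₁) + p₂ * (m - p₁ - q₂)) := by
  have := h₀.le_mul
  have := h₁.le_mul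
  have := h₂.le_mul
  have := h₀.nonneg
  have := h₁.nonneg
  have := h₂.nonneg
  have key : 0 ≤ m ^ 2 - m * (p₀ + p₁ + p₂) + p₀ * p₁ + p₁ * p₂ + p₂ * p₀ := by
    rcases le_total m (p₀ + p₁) with h | h <;> nlinarith
  nlinarith

lemma excess_le (h₀ : BranchBounds c₀ n₀ p₀ q₀ E₀) (h₁ : BranchBounds c₁ n₁ p₁ q₁ E₁)
    (h₂ : BranchBounds c₂ n₂ p₂ q₂ E₂) (e₀ : p₁ + q₂ ≤ m) (e₁ : p₂ + q₀ ≤ m)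
    (e₂ : p₀ + q₁ ≤ m) (l₂ : n₂ < m) :
    m - p₀ - q₁ ≤ m ^ 2 - (E₀ + E₁ + E₂) := by
  have b0 := h₀.le_mul
  have b1 := h₁.le_mul
  have b2 := h₂.le_mul
  have := h₀.nonneg
  have := h₁.nonneg
  have := h₂.nonneg
  by_cases hm : p₂ = m ∧ q₂ = m
  · obtain ⟨rfl, rfl⟩ := hm
    have := h₂.le_sub_one_mul l₂ le_rfl le_rfl
    obtain rfl : p₁ = 0 := by omega
    obtain rfl : q₀ = 0 := by omega
    nlinarith
  · have key : m - p₀ - q₁ ≤ m * (m - p₀ - q₁) + p₀ * p₂ + q₁ * q₂ - p₂ * q₂ := by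
      rcases le_total p₂ q₂ with h | h
      · have : p₂ ≤ m - 1 := by omega
        nlinarith
      · have : q₂ ≤ m - 1 := by omega
        nlinarith
    nlinarith

lemma single_le (h : BranchBounds c n p q E) (hn : n < m) (hp : p ≤ m) (hq : q ≤ m)
    (hm : 0 < m) : E ≤ (m - 1) ^ 2 + p := by
  rcases h with ⟨h1, h2, h3, h4, h5⟩ | ⟨h1, h2, h3, h4, h5, h6⟩
  · nlinarith
  · rcases max_cases p q with ⟨h, _⟩ | ⟨h, _⟩ <;> rw [h] at h6 <;> nlinarith

lemma single_excess_le (h : BranchBounds c n p q E) (hn : n < m) (hp : p ≤ m) (hq : q ≤ m)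
    (hc : c = 1) : m + (m - p) + (m - q) - 2 ≤ m ^ 2 - E ∧ (m - p) + (m - q) ≤ m ^ 2 - E := by
  have h7 := h.le_sub_one_mul hn hp hq
  have h8 := h.le_mul
  rcases h with ⟨h1, h2, h3, h4, h5⟩ | ⟨h1, h2, h3, h4, h5, h6⟩
  · omega
  by_cases hpq : p = m ∧ q = m
  · obtain ⟨rfl, rfl⟩ := hpq
    constructor <;> nlinarith
  · have : (p - 1) * (q - 1) ≤ (m - 2) * (m - 1) := by
      rcases le_total p q with h | h
      · have : p ≤ m - 1 := by omega
        exact mul_le_mul (by omega) (by omega) (by omega) (by omega)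
      · have : q ≤ m - 1 := by omega
        rw [mul_comm]
        exact mul_le_mul (by omega) (by omega) (by omega) (by omega)
    constructor <;> nlinarith

lemma pair_excess_le (h₁ : BranchBounds c₁ n₁ p₁ q₁ E₁) (h₂ : BranchBounds c₂ n₂ p₂ q₂ E₂)
    (e₀ : p₁ + q₂ ≤ m) (e₁ : p₂ ≤ m) (e₂ : q₁ ≤ m) (hp : 1 ≤ p₁) (hq : 1 ≤ q₂) :
    (m - p₁ - q₂) + (m - p₂) + (m - q₁) - 1 ≤ m ^ 2 - (E₁ + E₂) := by
  have := h₁.le_mul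
  have := h₂.le_mul
  have := mul_nonneg (sub_nonneg.2 hp) (sub_nonneg.2 e₂)
  have := mul_nonneg (sub_nonneg.2 hq) (sub_nonneg.2 e₁)
  nlinarith

lemma pair_excess_le_of_pos (h₀ : BranchBounds c₀ n₀ p₀ q₀ E₀)
    (h₁ : BranchBounds c₁ n₁ p₁ q₁ E₁) (e₀ : p₁ ≤ m) (e₁ : q₀ ≤ m) (e₂ : p₀ + q₁ ≤ m)
    (hp₀ : 1 ≤ p₀) (hq₁ : 1 ≤ q₁) :
    (m - q₀) + (m - p₀ - q₁) ≤ m ^ 2 - (E₀ + E₁) := by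
  have := h₀.le_mul
  have := h₁.le_mul
  have : (p₁ - 1) * q₁ ≤ (m - 1) * q₁ := mul_le_mul_of_nonneg_right (by omega) (by omega)
  have : (q₀ - 1) * (p₀ - 1) ≤ (m - 1) * (p₀ - 1) :=
    mul_le_mul_of_nonneg_right (by omega) (by omega)
  nlinarith

lemma two_excess_le (h₀ : BranchBounds c₀ n₀ p₀ q₀ E₀) (h₁ : BranchBounds c₁ n₁ p₁ q₁ E₁)
    (h₂ : BranchBounds c₂ n₂ p₂ q₂ E₂) (e₀ : p₁ + q₂ ≤ m) (e₁ : p₂ + q₀ ≤ m)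
    (e₂ : p₀ + q₁ ≤ m) (l₀ : n₀ < m) (l₁ : n₁ < m) (l₂ : n₂ < m) (hm : 0 < m) :
    (m - p₂ - q₀) + (m - p₀ - q₁) - 1 + c₀ ≤ m ^ 2 - (E₀ + E₁ + E₂) := by
  have H := sum_le_sq h₀ h₁ h₂ e₀ e₁ e₂
  rcases id h₀ with ⟨rfl, rfl, rfl, rfl, rfl⟩ | ⟨rfl, hn₀, hp₀, hq₀, -, -⟩ <;>
  rcases id h₁ with ⟨rfl, rfl, rfl, rfl, rfl⟩ | ⟨rfl, hn₁, hp₁, hq₁, -, -⟩ <;>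
  rcases id h₂ with ⟨rfl, rfl, rfl, rfl, rfl⟩ | ⟨rfl, hn₂, hp₂, hq₂, -, -⟩
  · nlinarith
  · linarith [h₂.single_le l₂ (by omega) (by omega) hm]
  · linarith [h₁.swap.single_le l₁ (by omega) (by omega) hm]
  · linarith [pair_excess_le h₁ h₂ e₀ (by omega) (by omega) (by omega) (by omega)]
  · linarith [(h₀.single_excess_le l₀ (by omega) (by omega) rfl).2]
  · linarith [pair_excess_le_of_pos h₀.swap h₂.swap (m := m) (by omega) (by omega) (by omega)
      (by omega) (by omega)]
  · linarith [pair_excess_le_of_pos h₀ h₁ (m := m) (by omega) (by omega) (by omega)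
      (by omega) (by omega)]
  · have := mul_nonneg (show 0 ≤ p₀ - 1 by omega) (show 0 ≤ m - p₂ - q₀ by omega)
    have := mul_nonneg (show 0 ≤ p₁ - 1 by omega) (show 0 ≤ m - p₀ - q₁ by omega)
    have := mul_nonneg (show 0 ≤ p₂ by omega) (show 0 ≤ m - p₁ - q₂ by omega)
    linarith

lemma three_excess_le (h₀ : BranchBounds c₀ n₀ p₀ q₀ E₀) (h₁ : BranchBounds c₁ n₁ p₁ q₁ E₁)
    (h₂ : BranchBounds c₂ n₂ p₂ q₂ E₂) (e₀ : p₁ + q₂ ≤ m) (e₁ : p₂ + q₀ ≤ m)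
    (e₂ : p₀ + q₁ ≤ m) (l₀ : n₀ < m) (l₁ : n₁ < m) (l₂ : n₂ < m) :
    (m - p₁ - q₂) + (m - p₂ - q₀) + (m - p₀ - q₁) - 3 + (c₀ + c₁ + c₂) ≤
      m ^ 2 - (E₀ + E₁ + E₂) := by
  have H := sum_le_sq h₀ h₁ h₂ e₀ e₁ e₂
  rcases id h₀ with ⟨rfl, rfl, rfl, rfl, rfl⟩ | ⟨rfl, hn₀, hp₀, hq₀, -, -⟩ <;>
  rcases id h₁ with ⟨rfl, rfl, rfl, rfl, rfl⟩ | ⟨rfl, hn₁, hp₁, hq₁, -, -⟩ <;>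
  rcases id h₂ with ⟨rfl, rfl, rfl, rfl, rfl⟩ | ⟨rfl, hn₂, hp₂, hq₂, -, -⟩
  · nlinarith [sq_nonneg (m - 1), sq_nonneg (m - 2)]
  · linarith [(h₂.single_excess_le l₂ (by omega) (by omega) rfl).1]
  · linarith [(h₁.single_excess_le l₁ (by omega) (by omega) rfl).1]
  · linarith [pair_excess_le h₁ h₂ e₀ (by omega) (by omega) (by omega) (by omega)]
  · linarith [(h₀.single_excess_le l₀ (by omega) (by omega) rfl).1]
  · linarith [pair_excess_le h₂ h₀ e₁ (by omega) (by omega) (by omega) (by omega)]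
  · linarith [pair_excess_le h₀ h₁ e₂ (by omega) (by omega) (by omega) (by omega)]
  · have := mul_nonneg (show 0 ≤ p₀ - 1 by omega) (show 0 ≤ m - p₂ - q₀ by omega)
    have := mul_nonneg (show 0 ≤ p₁ - 1 by omega) (show 0 ≤ m - p₀ - q₁ by omega)
    have := mul_nonneg (show 0 ≤ p₂ - 1 by omega) (show 0 ≤ m - p₁ - q₂ by omega)
    linarith

end BranchBounds

namespace ToricCluster

open ToricConstellation

variable {r : ℕ} {A : ToricCluster r} {i : Fin r} {a : Fin 3}

lemma sum_labels (f : Fin 3 → ℤ) (a : Fin 3) : ∑ b, f b = f a + f (a + 1) + f (a + 2) := by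
  fin_cases a <;> simp [Fin.sum_univ_three] <;> ring

lemma add_labels (a : Fin 3) :
    a + 1 + 1 = a + 2 ∧ a + 1 + 2 = a ∧ a + 2 + 1 = a ∧ a + 2 + 2 = a + 1 := by
  decide +revert

lemma Idealistic.branchBounds (hA : A.Idealistic) (i : Fin r) (a : Fin 3) :
    BranchBounds (A.branchSum a (fun _ => 1) i) (A.branchSum a A.m i) (A.M i a (a + 1))
      (A.M i a (a + 2)) (A.branchSum a (A.reachSum {a}ᶜ fun k => A.m k ^ 2) i) := by
  classical
  rw [M_eq_branchSum, M_eq_branchSum]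
  rcases A.branchSum_cases a i with ⟨x, -, -, h⟩ | ⟨-, h⟩
  · simp only [h]
    refine Or.inr ⟨rfl, A.m_pos x, A.weight_le_reachSum _ x, A.weight_le_reachSum _ x, ?_,
      hA.reachSum_sq_le a x⟩
    exact single_le_sum (f := fun k => A.m k ^ 2) (fun k _ => sq_nonneg _)
      (by simp [Relation.ReflTransGen.refl])
  · simp only [h]
    exact Or.inl ⟨rfl, rfl, rfl, rfl, rfl⟩

lemma branchSum_weight_eq_iff (A : ToricCluster r) (i : Fin r) (a : Fin 3) :
    A.branchSum a A.m i = A.m i ↔ ∃ j, A.IsChild j i ∧ A.label j = a ∧ A.m j = A.m i := by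
  constructor
  · intro h
    rcases A.branchSum_cases a i with ⟨x, hx, hl, h'⟩ | ⟨-, h'⟩
    · exact ⟨x, hx, hl, h' A.m ▸ h⟩
    · have := A.m_pos i
      have := h' A.m
      omega
  · rintro ⟨x, hx, hl, h⟩
    rw [branchSum_of_child hx hl, h]

lemma Idealistic.chi_of_weight_eq (hA : A.Idealistic) (h : A.branchSum a A.m i = A.m i) :
    (∀ b, A.branchSum b A.m i = A.m i → b = a) ∧
    A.chi i = 3 - (if a ∈ A.labelsUnder i then 0 else A.m i)
      - (if A.labelsUnder i ⊆ {a} then 1 else 0)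
      - 2 * (A.labelsUnder i).card + ((A.labelsUnder i).card.choose 2 : ℕ) := by
  have h0 := A.m_pos i
  have b0 := hA.branchBounds i a
  have b1 := hA.branchBounds i (a + 1)
  have b2 := hA.branchBounds i (a + 2)
  have e0 := hA.excess_nonneg a i
  have e1 := hA.excess_nonneg (a + 1) i
  have e2 := hA.excess_nonneg (a + 2) i
  obtain ⟨a1, a2, a3, a4⟩ := add_labels a
  rw [chi_eq, sum_labels _ a, sum_labels _ a, sum_labels _ a]
  simp only [excess, a1, a2, a3, a4] at *
  have hE := b0.le_mul
  rcases b0 with ⟨_, _, _, _, _⟩ | ⟨hc, hn, hp, hq, hs, -⟩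
  · omega
  have hp' : A.M i a (a + 1) = A.m i := by
    have := b1.nonneg
    omega
  have hq' : A.M i a (a + 2) = A.m i := by
    have := b2.nonneg
    omega
  rcases b1 with ⟨c1, n1, p1, q1, E1⟩ | ⟨_, _, _, _, _⟩
  swap
  · omega
  rcases b2 with ⟨c2, n2, p2, q2, E2⟩ | ⟨_, _, _, _, _⟩
  swap
  · omega
  constructor
  · intro b hb
    by_contra hne
    rcases (other_labels a).2.2.2 b hne with rfl | rfl <;> omega
  · rw [hp', hq'] at hE
    rw [h] at hs
    rw [hc, c1, c2, E1, E2, p1, q1, p2, q2, hp', hq']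
    simp
    split_ifs <;> linarith

lemma Idealistic.chi_nonneg (hA : A.Idealistic) (h : ∀ a, A.branchSum a A.m i ≠ A.m i) :
    0 ≤ A.chi i := by
  have h0 := A.m_pos i
  have lt : ∀ a, A.branchSum a A.m i < A.m i := by
    intro a
    refine lt_of_le_of_ne ?_ (h a)
    have e := hA.excess_nonneg (a + 1) i
    have b := hA.branchBounds i (a + 2)
    rw [excess] at e
    obtain ⟨a1, a2, a3, a4⟩ := add_labels a
    rw [a1, a2] at e
    rw [a3, a4] at b
    have := b.nonneg
    rcases hA.branchBounds i a with ⟨_, _, _, _, _⟩ | ⟨_, _, _, _, _⟩ <;> omega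
  have b0 := hA.branchBounds i 0
  have b1 := hA.branchBounds i 1
  have b2 := hA.branchBounds i 2
  have e0 := hA.excess_nonneg 0 i
  have e1 := hA.excess_nonneg 1 i
  have e2 := hA.excess_nonneg 2 i
  have l0 := lt 0
  have l1 := lt 1
  have l2 := lt 2
  rw [chi_eq]
  simp only [excess, Fin.sum_univ_three, Fin.reduceAdd] at *
  have hS : ∀ S : Finset (Fin 3), S = ∅ ∨ S = {0} ∨ S = {1} ∨ S = {2} ∨ S = {0, 1} ∨
      S = {0, 2} ∨ S = {1, 2} ∨ S = {0, 1, 2} := by decide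
  rcases hS (A.labelsUnder i) with h | h | h | h | h | h | h | h <;> rw [h]
  · have := b0.three_excess_le b1 b2 (m := A.m i) (by omega) (by omega) (by omega) l0 l1 l2
    simp
    omega
  · have := b0.two_excess_le b1 b2 (m := A.m i) (by omega) (by omega) (by omega) l0 l1 l2 h0
    simp
    omega
  · have := b1.two_excess_le b2 b0 (m := A.m i) (by omega) (by omega) (by omega) l1 l2 l0 h0
    simp
    omega
  · have := b2.two_excess_le b0 b1 (m := A.m i) (by omega) (by omega) (by omega) l2 l0 l1 h0
    simp
    omega
  · have := b0.excess_le b1 b2 (m := A.m i) (by omega) (by omega) (by omega) l2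
    have hs : ∀ a : Fin 3, ¬ ({0, 1} : Finset (Fin 3)) ⊆ {a} := by decide
    simp [hs, -subset_singleton_iff]
    omega
  · have := b2.excess_le b0 b1 (m := A.m i) (by omega) (by omega) (by omega) l1
    have hs : ∀ a : Fin 3, ¬ ({0, 2} : Finset (Fin 3)) ⊆ {a} := by decide
    simp [hs, -subset_singleton_iff]
    omega
  · have := b1.excess_le b2 b0 (m := A.m i) (by omega) (by omega) (by omega) l0
    have hs : ∀ a : Fin 3, ¬ ({1, 2} : Finset (Fin 3)) ⊆ {a} := by decide
    simp [hs, -subset_singleton_iff]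
    omega
  · have := b0.sum_le_sq b1 b2 (m := A.m i) (by omega) (by omega) (by omega)
    have := mul_nonneg b0.nonneg.1 (show 0 ≤ A.m i - A.M i 2 0 - A.M i 0 2 by omega)
    have := mul_nonneg b1.nonneg.1 (show 0 ≤ A.m i - A.M i 0 1 - A.M i 1 0 by omega)
    have := mul_nonneg b2.nonneg.1 (show 0 ≤ A.m i - A.M i 1 2 - A.M i 2 1 by omega)
    have hs : ∀ a : Fin 3, ¬ ({0, 1, 2} : Finset (Fin 3)) ⊆ {a} := by decide
    simp [hs, -subset_singleton_iff]
    omega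

lemma euler_neg_iff {m : ℤ} (hm : 0 < m) (S : Finset (Fin 3)) (a : Fin 3) :
    3 - (if a ∈ S then 0 else m) - (if S ⊆ {a} then 1 else 0) - 2 * (S.card : ℤ) +
      (S.card.choose 2 : ℕ) < 0 ↔ a ∉ S ∧ (S = ∅ → 3 ≤ m) ∧ (S.card = 1 → 2 ≤ m) := by
  rcases Nat.lt_or_ge S.card 2 with h | h
  · rcases Nat.lt_or_ge S.card 1 with h' | h'
    · obtain rfl : S = ∅ := by simpa using h'
      simp
      omega
    · have h1 : S.card = 1 := by omega
      obtain ⟨b, rfl⟩ := card_eq_one.1 h1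
      by_cases hab : a = b
      · simp [hab]
      · simp [hab, Ne.symm hab]
        omega
  · have h0 : S ≠ ∅ := by
      rintro rfl
      simp at h
    have hsub : ¬ S ⊆ {a} := fun hs => by
      have := card_le_card hs
      simp at this
      omega
    have h3 : S.card ≤ 3 := card_finset_fin_le S
    have hT : 3 - 2 * (S.card : ℤ) + (S.card.choose 2 : ℕ) = 0 := by
      obtain h | h : S.card = 2 ∨ S.card = 3 := by omega
      all_goals simp [h]
    have h1 : S.card ≠ 1 := by omega
    simp only [hsub, h0, h1, if_false, false_imp_iff, and_true]
    split_ifs with ha <;> simp [ha] <;> omega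

end ToricCluster

open ToricConstellation ToricCluster

theorem stmt7 {r : ℕ} (A : ToricCluster r) (hA : A.Idealistic) (i : Fin r) :
    A.chi i < 0 ↔
      ∃ (a : Fin 3) (j : Fin r),
        IsChild A.toToricConstellation j i
        ∧ A.toToricConstellation.label j = a
        ∧ A.m j = A.m i
        ∧ a ∉ labelsUnder A.toToricConstellation i
        ∧ (labelsUnder A.toToricConstellation i = ∅ → 3 ≤ A.m i)
        ∧ ((labelsUnder A.toToricConstellation i).card = 1 → 2 ≤ A.m i) := by
  by_cases h : ∃ a, A.branchSum a A.m i = A.m i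
  · obtain ⟨a, ha⟩ := h
    obtain ⟨huniq, hchi⟩ := hA.chi_of_weight_eq ha
    rw [hchi, euler_neg_iff (A.m_pos i)]
    constructor
    · intro h
      obtain ⟨j, hj, hl, hm⟩ := (A.branchSum_weight_eq_iff i a).1 ha
      exact ⟨a, j, hj, hl, hm, h⟩
    · rintro ⟨b, j, hj, hl, hm, h⟩
      rwa [← huniq b ((A.branchSum_weight_eq_iff i b).2 ⟨j, hj, hl, hm⟩)]
  · push Not at h
    refine iff_of_false (hA.chi_nonneg h).not_gt ?_
    rintro ⟨a, j, hj, hl, hm, -⟩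
    exact h a ((A.branchSum_weight_eq_iff i a).2 ⟨j, hj, hl, hm⟩)
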